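/- Suppose λ > δℛ_i for all i = 1,…,L and that 1 lies in the support of the distribution of r. Then for every pair u, w ∈ 𝕊^L there exist N ∈ ℕ, scalars s_1,…,s_N in the support of the distribution of r, and orthogonal matrices 𝒰_1,…,𝒰_N ∈ O(L+1) such that w = ℛ(1+λ s_N 𝒰_N) · … · ℛ(1+λ s_1 𝒰_1) · u. -/

import Mathlib

open MeasureTheory ProbabilityTheory Matrix Real
open scoped ENNReal

noncomputable section

abbrev Sph (L : ℕ) := Metric.sphere (0 : EuclideanSpace ℝ (Fin (L+1))) 1

/-- The projective action `T · v = T v / ‖T v‖` on vectors. -/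
noncomputable def act {n : ℕ} (T : Matrix (Fin n) (Fin n) ℝ)
    (v : EuclideanSpace ℝ (Fin n)) : EuclideanSpace ℝ (Fin n) :=
  ‖Matrix.toEuclideanLin T v‖⁻¹ • Matrix.toEuclideanLin T v

/-- The projective action on the unit sphere (junk value `v` if `T v = 0`). -/
noncomputable def actS {L : ℕ} (T : Matrix (Fin (L+1)) (Fin (L+1)) ℝ) (v : Sph L) : Sph L :=
  if h : ‖Matrix.toEuclideanLin T (v : EuclideanSpace ℝ (Fin (L+1)))‖ = 0 then v
  else ⟨act T v, by
    rw [mem_sphere_zero_iff_norm, act, norm_smul, norm_inv, norm_norm, inv_mul_cancel₀ h]⟩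

instance {m n α : Type*} [MeasurableSpace α] : MeasurableSpace (Matrix m n α) :=
  inferInstanceAs (MeasurableSpace (m → n → α))

/-- `U` is Haar distributed on the orthogonal group `O(L+1)`: it takes values in the
orthogonal group and its law is invariant under left translation (which characterizes
the Haar probability measure on this compact group). -/
def IsHaarOrth {L : ℕ} {Ω : Type*} [MeasurableSpace Ω] (P : Measure Ω)
    (U : Ω → Matrix (Fin (L+1)) (Fin (L+1)) ℝ) : Prop :=
  Measurable U ∧ (∀ ω, U ω ∈ Matrix.orthogonalGroup (Fin (L+1)) ℝ) ∧
    ∀ O ∈ Matrix.orthogonalGroup (Fin (L+1)) ℝ,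
      Measure.map (fun ω => O * U ω) P = Measure.map U P

/-- `ν` is the normalized rotation-invariant surface measure on the sphere: it is the unique
rotation-invariant Borel probability measure. -/
def IsUniformSphere {L : ℕ} (ν : Measure (Sph L)) : Prop :=
  IsProbabilityMeasure ν ∧
    ∀ O ∈ Matrix.orthogonalGroup (Fin (L+1)) ℝ, Measure.map (actS O) ν = ν

/-- Topological support of a measure. -/
def msupport {X : Type*} [TopologicalSpace X] [MeasurableSpace X] (μ : Measure X) : Set X :=
  {x | ∀ s : Set X, IsOpen s → x ∈ s → 0 < μ s}

/-- `‖𝔞(v)‖²`, the squared norm of the first `La` components. -/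
noncomputable def naSq {n : ℕ} (La : ℕ) (v : EuclideanSpace ℝ (Fin n)) : ℝ :=
  ∑ k : Fin n, if (k : ℕ) < La then (v k)^2 else 0

/-- `‖𝔠(v)‖²`, the squared norm of the components with index `> La + Lb`. -/
noncomputable def ncSq {n : ℕ} (Lab : ℕ) (v : EuclideanSpace ℝ (Fin n)) : ℝ :=
  ∑ k : Fin n, if Lab ≤ (k : ℕ) then (v k)^2 else 0

/-- Ordered application of the (random) matrices `M 0, …, M (N-1)` to `v`. -/
noncomputable def chainW {L : ℕ} {Ω : Type*}
    (M : ℕ → Ω → Matrix (Fin (L+1)) (Fin (L+1)) ℝ) :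
    ℕ → Ω → Sph L → Sph L
  | 0, _, v => v
  | (n+1), ω, v => actS (M n ω) (chainW M n ω v)

/-- Ordered application of the matrices `M 0, …, M (N-1)` to `v` (deterministic). -/
noncomputable def chainD {L : ℕ} (M : ℕ → Matrix (Fin (L+1)) (Fin (L+1)) ℝ) :
    ℕ → Sph L → Sph L
  | 0, v => v
  | (n+1), v => actS (M n) (chainD M n v)

/-- `w` is, up to a positive factor, the image under `diagonal d` of a point at distance at most
`lam * ‖v‖` from `v`. -/
def ControlStep {n : ℕ} (lam : ℝ) (d : Fin n → ℝ) (v w : EuclideanSpace ℝ (Fin n)) : Prop :=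
  ∃ c : ℝ, 0 < c ∧ ∃ z, ‖z - v‖ ≤ lam * ‖v‖ ∧ c • w = Matrix.toEuclideanLin (diagonal d) z

/-- `w` can be reached from `v` by finitely many control steps. -/
abbrev ControlReach {n : ℕ} (lam : ℝ) (d : Fin n → ℝ) :
    EuclideanSpace ℝ (Fin n) → EuclideanSpace ℝ (Fin n) → Prop :=
  Relation.ReflTransGen (ControlStep lam d)

/-- The vector `v` with every coordinate other than the `m`-th multiplied by `b k ^ j`. -/
def dampedVec {n : ℕ} (b : Fin n → ℝ) (m : Fin n) (v : EuclideanSpace ℝ (Fin n)) (j : ℕ) :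
    EuclideanSpace ℝ (Fin n) :=
  WithLp.toLp 2 fun k => if k = m then v m else b k ^ j * v k

lemma toEuclideanLin_diagonal_apply {n : ℕ} (d : Fin n → ℝ) (v : EuclideanSpace ℝ (Fin n))
    (k : Fin n) : Matrix.toEuclideanLin (diagonal d) v k = d k * v k := by
  simp [Matrix.toLpLin_apply, Matrix.mulVec_diagonal]

lemma EuclideanSpace.norm_le_norm_of_abs_le {n : ℕ} {v w : EuclideanSpace ℝ (Fin n)}
    (h : ∀ k, |v k| ≤ |w k|) : ‖v‖ ≤ ‖w‖ := by
  rw [EuclideanSpace.norm_eq, EuclideanSpace.norm_eq]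
  refine Real.sqrt_le_sqrt (Finset.sum_le_sum fun k _ => ?_)
  simpa using sq_le_sq.2 (h k)

lemma dampedVec_zero {n : ℕ} (b : Fin n → ℝ) (m : Fin n) (v : EuclideanSpace ℝ (Fin n)) :
    dampedVec b m v 0 = v := by
  ext k
  by_cases hk : k = m <;> simp [dampedVec, hk]

lemma exists_norm_dampedVec_sub_single_le {n : ℕ} {b : Fin n → ℝ} {m : Fin n}
    {v : EuclideanSpace ℝ (Fin n)} (hb0 : ∀ k, 0 ≤ b k)
    (hb1 : ∀ k, k ≠ m → v k ≠ 0 → b k < 1) {ε : ℝ} (hε : 0 < ε) :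
    ∃ j, ‖dampedVec b m v j - EuclideanSpace.single m (v m)‖ ≤ ε := by
  have hlim : Filter.Tendsto
      (fun j => ‖dampedVec b m v j - EuclideanSpace.single m (v m)‖) Filter.atTop (nhds 0) := by
    have hsum : Filter.Tendsto
        (fun j => ∑ k, ‖(dampedVec b m v j - EuclideanSpace.single m (v m)) k‖ ^ 2)
        Filter.atTop (nhds (∑ _k : Fin n, (0 : ℝ))) := by
      refine tendsto_finsetSum _ fun k _ => ?_
      by_cases hk : k = m
      · simp [dampedVec, hk]
      · by_cases hv : v k = 0
        · simp [dampedVec, hk, hv]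
        · have := ((tendsto_pow_atTop_nhds_zero_of_lt_one (hb0 k) (hb1 k hk hv)).mul_const
            (v k)).norm.pow 2
          simpa [dampedVec, hk] using this
    have := (Real.continuous_sqrt.tendsto _).comp hsum
    simp only [Finset.sum_const_zero, Real.sqrt_zero] at this
    refine this.congr fun j => ?_
    rw [Function.comp_apply, EuclideanSpace.norm_eq]
  exact ((hlim.eventually (gt_mem_nhds hε)).exists).imp fun j hj => hj.le

/-- A vector is steered onto the axis of a nonzero coordinate whose amplification, boosted by
`1 + lam`, dominates that of all its other nonzero coordinates. -/
lemma ControlReach.to_single {n : ℕ} {lam : ℝ} (hlam : 0 < lam) {d : Fin n → ℝ}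
    (hd : ∀ k, 0 < d k) {m : Fin n} {v : EuclideanSpace ℝ (Fin n)} (hvm : v m ≠ 0)
    (hdom : ∀ k, k ≠ m → v k ≠ 0 → d k < (1 + lam) * d m) {c : ℝ} (hc : 0 < c * v m) :
    ControlReach lam d v (EuclideanSpace.single m c) := by
  set b : Fin n → ℝ := fun k => d k / ((1 + lam) * d m) with hb
  have hpos : 0 < (1 + lam) * d m := mul_pos (by linarith) (hd m)
  have hvec : ∀ j, dampedVec b m v j m = v m := fun j => by simp [dampedVec]
  have hnorm : ∀ j, lam * |v m| ≤ lam * ‖dampedVec b m v j‖ := fun j => by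
    have := PiLp.norm_apply_le (dampedVec b m v j) m
    rw [hvec, Real.norm_eq_abs] at this
    gcongr
  have hreach : ∀ j, ControlReach lam d v (dampedVec b m v j) := by
    intro j
    induction j with
    | zero => rw [dampedVec_zero]
    | succ j ih =>
      refine ih.tail ⟨(1 + lam) * d m, hpos,
        dampedVec b m v j + EuclideanSpace.single m (lam * v m), ?_, ?_⟩
      · simpa [abs_mul, abs_of_pos hlam] using hnorm j
      · ext k
        rw [toEuclideanLin_diagonal_apply]
        by_cases hk : k = m
        · subst hk
          simp [dampedVec]
          ring
        · have : (1 + lam) * d m * b k = d k := mul_div_cancel₀ _ hpos.ne'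
          simp [dampedVec, hk, pow_succ]
          rw [← this]
          ring
  obtain ⟨j, hj⟩ := exists_norm_dampedVec_sub_single_le (b := b) (m := m) (v := v)
    (fun k => (div_pos (hd k) hpos).le)
    (fun k hk hv => (div_lt_one hpos).2 (hdom k hk hv)) (mul_pos hlam (abs_pos.2 hvm))
  have hc0 : c ≠ 0 := by rintro rfl; simp at hc
  refine (hreach j).tail ⟨d m * (v m / c), mul_pos (hd m) ?_,
    EuclideanSpace.single m (v m), ?_, ?_⟩
  · rw [← mul_div_mul_left _ _ hc0]
    exact div_pos hc (mul_self_pos.2 hc0)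
  · rw [norm_sub_rev]
    exact hj.trans (hnorm j)
  · ext k
    rw [toEuclideanLin_diagonal_apply]
    by_cases hk : k = m
    · subst hk
      simp
      field_simp
    · simp [hk]

/-- Any axis of dominant amplification is reached from any nonzero vector. -/
lemma ControlReach.exists_to_single {n : ℕ} {lam : ℝ} (hlam : 0 < lam) {d : Fin n → ℝ}
    (hd : ∀ k, 0 < d k) {m : Fin n} (hm : ∀ k, d k ≤ d m) {v : EuclideanSpace ℝ (Fin n)}
    (hv : v ≠ 0) : ∃ c : ℝ, c ≠ 0 ∧ ControlReach lam d v (EuclideanSpace.single m c) := by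
  have hdom : ∀ k, d k < (1 + lam) * d m := fun k =>
    (hm k).trans_lt (by nlinarith [mul_pos hlam (hd m)])
  by_cases hvm : v m = 0
  · set w := Matrix.toEuclideanLin (diagonal d) (v + EuclideanSpace.single m (lam * ‖v‖)) with hw
    have hwm : 0 < w m := by
      rw [hw, toEuclideanLin_diagonal_apply]
      have := mul_pos (hd m) (mul_pos hlam (norm_pos_iff.2 hv))
      simpa [hvm] using this
    refine ⟨1, one_ne_zero, Relation.ReflTransGen.head ⟨1, one_pos, _, ?_, one_smul ℝ w⟩
      (ControlReach.to_single hlam hd hwm.ne' (fun k _ _ => hdom k) (by simpa using hwm))⟩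
    simp [abs_of_pos hlam]
  · exact ⟨v m, hvm, ControlReach.to_single hlam hd hvm (fun k _ _ => hdom k)
      (mul_self_pos.2 hvm)⟩

/-- One axis is reached from another one, with either sign, if its amplification, boosted by
`1 + lam`, exceeds that of the other. -/
lemma ControlReach.single_single {n : ℕ} {lam : ℝ} (hlam : 0 < lam) {d : Fin n → ℝ}
    (hd : ∀ k, 0 < d k) {l m : Fin n} (hlm : l ≠ m) (hdom : d l < (1 + lam) * d m)
    {a c : ℝ} (ha : a ≠ 0) (hc : c ≠ 0) :
    ControlReach lam d (EuclideanSpace.single l a) (EuclideanSpace.single m c) := by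
  set t := lam * |a| / |c| with ht
  have htpos : 0 < t := div_pos (mul_pos hlam (abs_pos.2 ha)) (abs_pos.2 hc)
  set w := Matrix.toEuclideanLin (diagonal d)
    (EuclideanSpace.single l a + EuclideanSpace.single m (t * c)) with hw
  have hwm : w m = d m * (t * c) := by
    rw [hw, toEuclideanLin_diagonal_apply]
    simp [hlm.symm]
  refine Relation.ReflTransGen.head ⟨1, one_pos, _, ?_, one_smul ℝ w⟩
    (ControlReach.to_single hlam hd ?_ ?_ ?_)
  · have : t * |c| = lam * |a| := by
      rw [ht]; field_simp
    simp [abs_of_pos htpos, this]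
  · rw [hwm]
    exact mul_ne_zero (hd m).ne' (mul_ne_zero htpos.ne' hc)
  · intro k hkm hk
    have : k = l := by
      by_contra hkl
      apply hk
      rw [hw, toEuclideanLin_diagonal_apply]
      simp [hkm, hkl]
    rwa [this]
  · rw [hwm]
    have := mul_pos (mul_pos (hd m) htpos) (mul_self_pos.2 hc)
    linarith

/-- Any vector with a nonzero coordinate on an axis of minimal amplification is reached from that
axis. -/
lemma ControlReach.from_single {n : ℕ} {lam : ℝ} (hlam : 0 < lam) {d : Fin n → ℝ}
    (hd : ∀ k, 0 < d k) {m : Fin n} (hm : ∀ k, d m ≤ d k) {w : EuclideanSpace ℝ (Fin n)}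
    (hwm : w m ≠ 0) : ControlReach lam d (EuclideanSpace.single m (w m)) w := by
  have h1 : 0 < 1 + lam := by linarith
  set b : Fin n → ℝ := fun k => d m / ((1 + lam) * d k) with hb
  have hpos : ∀ k, 0 < (1 + lam) * d k := fun k => mul_pos h1 (hd k)
  set z : ℕ → EuclideanSpace ℝ (Fin n) := fun j =>
    EuclideanSpace.single m (w m) +
      (1 + lam) • (dampedVec b m w (j + 1) - EuclideanSpace.single m (w m)) with hz
  have himage : ∀ j, d m • dampedVec b m w j = Matrix.toEuclideanLin (diagonal d) (z j) := by
    intro j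
    ext k
    rw [toEuclideanLin_diagonal_apply]
    by_cases hk : k = m
    · subst hk
      simp [hz, dampedVec]
    · have : d k * (1 + lam) * b k = d m := by
        have := (hd k).ne'
        rw [hb]; field_simp
      simp [hz, dampedVec, hk, pow_succ]
      rw [← this]
      ring
  have hreach : ∀ j, ControlReach lam d (dampedVec b m w j) w := by
    intro j
    induction j with
    | zero => rw [dampedVec_zero]
    | succ j ih =>
      refine ih.head ⟨d m, hd m, z j, ?_, himage j⟩
      have : z j - dampedVec b m w (j + 1) =
          lam • (dampedVec b m w (j + 1) - EuclideanSpace.single m (w m)) := by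
        simp only [hz]
        module
      rw [this, norm_smul, Real.norm_eq_abs, abs_of_pos hlam]
      refine mul_le_mul_of_nonneg_left (EuclideanSpace.norm_le_norm_of_abs_le fun k => ?_) hlam.le
      by_cases hk : k = m <;> simp [dampedVec, hk]
  have hbnonneg : ∀ k, 0 ≤ b k := fun k => (div_pos (hd m) (hpos k)).le
  have hblt : ∀ k, b k < 1 := fun k =>
    (div_lt_one (hpos k)).2 (by nlinarith [hm k, mul_pos hlam (hd k)])
  obtain ⟨j, hj⟩ := exists_norm_dampedVec_sub_single_le (b := b) (m := m)
    (v := WithLp.toLp 2 fun k => if k = m then w m else b k * w k) hbnonneg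
    (fun k _ _ => hblt k) (div_pos (mul_pos hlam (abs_pos.2 hwm)) h1)
  have hshift : dampedVec b m (WithLp.toLp 2 fun k => if k = m then w m else b k * w k) j =
      dampedVec b m w (j + 1) := by
    ext k
    by_cases hk : k = m
    · simp [dampedVec, hk]
    · simp [dampedVec, hk, pow_succ, mul_assoc]
  rw [hshift] at hj
  simp only [if_true] at hj
  refine (hreach j).head ⟨d m, hd m, z j, ?_, himage j⟩
  rw [le_div_iff₀ h1] at hj
  simp only [hz, add_sub_cancel_left, norm_smul, Real.norm_eq_abs, abs_of_pos h1]
  rw [PiLp.norm_single, Real.norm_eq_abs]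
  linarith

/-- Any nonzero vector is reached from any axis of minimal amplification. -/
lemma ControlReach.exists_from_single {n : ℕ} {lam : ℝ} (hlam : 0 < lam) {d : Fin n → ℝ}
    (hd : ∀ k, 0 < d k) {m : Fin n} (hm : ∀ k, d m ≤ d k) {w : EuclideanSpace ℝ (Fin n)}
    (hw : w ≠ 0) : ∃ c : ℝ, c ≠ 0 ∧ ControlReach lam d (EuclideanSpace.single m c) w := by
  by_cases hwm : w m = 0
  · set z : EuclideanSpace ℝ (Fin n) := WithLp.toLp 2 fun k => w k / d k with hz
    have hwz : w = Matrix.toEuclideanLin (diagonal d) z := by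
      ext k
      rw [toEuclideanLin_diagonal_apply]
      have := (hd k).ne'
      simp [hz]
      field_simp
    have hzpos : 0 < ‖z‖ := by
      rw [norm_pos_iff]
      rintro h
      rw [h, map_zero] at hwz
      exact hw hwz
    have hzm : z m = 0 := by simp [hz, hwm]
    set v := z + EuclideanSpace.single m (lam * ‖z‖) with hv
    have hvm : v m = lam * ‖z‖ := by simp [hv, hzm]
    refine ⟨v m, hvm ▸ (mul_pos hlam hzpos).ne', (ControlReach.from_single hlam hd hm
      (hvm ▸ (mul_pos hlam hzpos).ne')).tail ⟨1, one_pos, z, ?_, by rw [one_smul, hwz]⟩⟩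
    have hle : ‖z‖ ≤ ‖v‖ := EuclideanSpace.norm_le_norm_of_abs_le fun k => by
      by_cases hk : k = m
      · rw [hk, hzm]; simp
      · simp [hv, hk]
    have : ‖z - v‖ = lam * ‖z‖ := by simp [hv, abs_of_pos hlam]
    rw [this]
    gcongr
  · exact ⟨w m, hwm, ControlReach.from_single hlam hd hm hwm⟩

/-- Complete controllability when consecutive amplifications differ by a factor less than
`1 + lam`. -/
lemma ControlReach.of_ne_zero {L : ℕ} (hL : 1 ≤ L) {lam : ℝ} (hlam : 0 < lam)
    {d : Fin (L + 1) → ℝ} (hd : ∀ k, 0 < d k) (hmono : Monotone d)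
    (hgap : ∀ k : Fin L, d k.succ < (1 + lam) * d k.castSucc)
    {v w : EuclideanSpace ℝ (Fin (L + 1))} (hv : v ≠ 0) (hw : w ≠ 0) :
    ControlReach lam d v w := by
  have hdown : ∀ k : Fin (L + 1), ∃ c : ℝ, c ≠ 0 ∧
      ControlReach lam d v (EuclideanSpace.single k c) := by
    intro k
    induction k using Fin.reverseInduction with
    | last => exact ControlReach.exists_to_single hlam hd (fun k => hmono (Fin.le_last k)) hv
    | cast k ih =>
      obtain ⟨c, hc, hreach⟩ := ih
      exact ⟨1, one_ne_zero, hreach.trans (ControlReach.single_single hlam hd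
        (Fin.castSucc_lt_succ (i := k)).ne' (hgap k) hc one_ne_zero)⟩
  obtain ⟨c, hc, hcw⟩ := ControlReach.exists_from_single hlam hd
    (fun k => hmono (Fin.zero_le k)) hw
  obtain ⟨a, ha, hva⟩ := hdown (Fin.succ ⟨0, hL⟩)
  exact hva.trans ((ControlReach.single_single hlam hd (Fin.succ_ne_zero _)
    (hgap ⟨0, hL⟩) ha hc).trans hcw)

/-- The orthogonal group acts transitively on the unit sphere. -/
lemma exists_orthogonal_apply_eq {n : ℕ} {x y : EuclideanSpace ℝ (Fin n)} (h : ‖x‖ = ‖y‖) :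
    ∃ U ∈ Matrix.orthogonalGroup (Fin n) ℝ, Matrix.toEuclideanLin U x = y := by
  set ρ : EuclideanSpace ℝ (Fin n) ≃ₗᵢ[ℝ] EuclideanSpace ℝ (Fin n) :=
    (Submodule.span ℝ {x - y})ᗮ.reflection with hρ
  set e := EuclideanSpace.basisFun (Fin n) ℝ with he
  refine ⟨LinearMap.toMatrix e.toBasis e.toBasis ρ.toLinearEquiv.toLinearMap,
    ρ.toMatrix_mem_unitaryGroup e e, ?_⟩
  rw [Matrix.toEuclideanLin_eq_toLin_orthonormal, Matrix.toLin_toMatrix]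
  exact Submodule.reflection_sub h

/-- A vector close to a unit vector `x` can be rescaled so as to have distance exactly `lam`
from `x`. -/
lemma exists_pos_norm_smul_sub_eq {E : Type*} [NormedAddCommGroup E] [NormedSpace ℝ E]
    {lam : ℝ} (hlam1 : lam < 1) {x z : E} (hx : ‖x‖ = 1)
    (hz : ‖z - x‖ ≤ lam) : ∃ t : ℝ, 0 < t ∧ ‖t • z - x‖ = lam := by
  have hcont : ContinuousOn (fun t : ℝ => ‖t • z - x‖) (Set.Icc 0 1) := by fun_prop
  obtain ⟨t, ht, htl⟩ := intermediate_value_Icc' zero_le_one hcont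
    (show lam ∈ Set.Icc ‖(1 : ℝ) • z - x‖ ‖(0 : ℝ) • z - x‖ by simp [hx, hz, hlam1.le])
  refine ⟨t, lt_of_le_of_ne ht.1 ?_, htl⟩
  rintro rfl
  simp [hx] at htl
  linarith

lemma coe_actS {L : ℕ} {T : Matrix (Fin (L + 1)) (Fin (L + 1)) ℝ} {v : Sph L}
    (h : Matrix.toEuclideanLin T (v : EuclideanSpace ℝ (Fin (L + 1))) ≠ 0) :
    (actS T v : EuclideanSpace ℝ (Fin (L + 1))) = act T v := by
  rw [actS, dif_neg (norm_ne_zero_iff.2 h)]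

lemma chainD_congr {L : ℕ} {M M' : ℕ → Matrix (Fin (L + 1)) (Fin (L + 1)) ℝ} {N : ℕ}
    (h : ∀ n < N, M n = M' n) (v : Sph L) : chainD M N v = chainD M' N v := by
  induction N with
  | zero => rfl
  | succ N ih =>
    rw [chainD, chainD, h N N.lt_succ_self, ih fun n hn => h n (hn.trans N.lt_succ_self)]

/-- A control step is realised on the sphere by a matrix `diagonal d * (1 + lam • U)`. -/
lemma ControlStep.exists_orthogonal {L : ℕ} {lam : ℝ} (hlam : 0 < lam) (hlam1 : lam < 1)
    {d : Fin (L + 1) → ℝ} {c : ℝ} (hc : 0 < c) {x : Sph L}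
    {w : EuclideanSpace ℝ (Fin (L + 1))} (hw : w ≠ 0)
    (h : ControlStep lam d (c • (x : EuclideanSpace ℝ (Fin (L + 1)))) w) :
    ∃ U ∈ Matrix.orthogonalGroup (Fin (L + 1)) ℝ, ∃ a : ℝ, 0 < a ∧
      a • (actS (diagonal d * (1 + lam • U)) x : EuclideanSpace ℝ (Fin (L + 1))) = w := by
  obtain ⟨e, he, z, hz, hwz⟩ := h
  have hx : ‖(x : EuclideanSpace ℝ (Fin (L + 1)))‖ = 1 := mem_sphere_zero_iff_norm.1 x.2
  have hz' : ‖c⁻¹ • z - x‖ ≤ lam := by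
    have : c⁻¹ • z - (x : EuclideanSpace ℝ (Fin (L + 1))) = c⁻¹ • (z - c • x) := by
      rw [smul_sub, inv_smul_smul₀ hc.ne']
    rw [this, norm_smul, norm_inv, Real.norm_eq_abs, abs_of_pos hc, inv_mul_le_iff₀ hc]
    rw [norm_smul, hx, Real.norm_eq_abs, abs_of_pos hc] at hz
    linarith
  obtain ⟨t, ht, htl⟩ := exists_pos_norm_smul_sub_eq hlam1 hx hz'
  obtain ⟨U, hU, hUx⟩ := exists_orthogonal_apply_eq
    (x := (x : EuclideanSpace ℝ (Fin (L + 1)))) (y := lam⁻¹ • (t • c⁻¹ • z - x)) (by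
      rw [hx, norm_smul, htl, norm_inv, Real.norm_eq_abs, abs_of_pos hlam,
        inv_mul_cancel₀ hlam.ne'])
  have himage : Matrix.toEuclideanLin (diagonal d * (1 + lam • U))
      (x : EuclideanSpace ℝ (Fin (L + 1))) = (t * c⁻¹ * e) • w := by
    rw [Matrix.toLpLin_mul_same, LinearMap.comp_apply, map_add, map_smul, Matrix.toLpLin_one,
      LinearMap.add_apply, LinearMap.smul_apply, hUx, smul_inv_smul₀ hlam.ne',
      LinearMap.id_apply, add_sub_cancel, map_smul, map_smul, ← hwz, smul_smul, smul_smul]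
  have hpos : 0 < t * c⁻¹ * e := mul_pos (mul_pos ht (inv_pos.2 hc)) he
  have hne : (t * c⁻¹ * e) • w ≠ 0 := smul_ne_zero hpos.ne' hw
  refine ⟨U, hU, ‖w‖, norm_pos_iff.2 hw, ?_⟩
  rw [coe_actS (himage ▸ hne), act, himage, norm_smul, Real.norm_eq_abs, abs_of_pos hpos,
    smul_smul, smul_smul]
  have : ‖w‖ * (t * c⁻¹ * e * ‖w‖)⁻¹ * (t * c⁻¹ * e) = 1 := by
    have := norm_ne_zero_iff.2 hw
    have := hpos.ne'
    field_simp
  rw [this, one_smul]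

lemma ControlStep.ne_zero_left {n : ℕ} {lam : ℝ} {d : Fin n → ℝ}
    {v w : EuclideanSpace ℝ (Fin n)} (h : ControlStep lam d v w) (hw : w ≠ 0) : v ≠ 0 := by
  rintro rfl
  obtain ⟨c, hc, z, hz, hwz⟩ := h
  have hz0 : z = 0 := by simpa using hz
  rw [hz0, map_zero] at hwz
  exact smul_ne_zero hc.ne' hw hwz

lemma ControlReach.exists_chainD {L : ℕ} {lam : ℝ} (hlam : 0 < lam) (hlam1 : lam < 1)
    {d : Fin (L + 1) → ℝ} {u : Sph L} {w : EuclideanSpace ℝ (Fin (L + 1))}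
    (h : ControlReach lam d u w) (hw : w ≠ 0) :
    ∃ (N : ℕ) (U : ℕ → Matrix (Fin (L + 1)) (Fin (L + 1)) ℝ),
      (∀ n < N, U n ∈ Matrix.orthogonalGroup (Fin (L + 1)) ℝ) ∧ ∃ c : ℝ, 0 < c ∧
      c • (chainD (fun n => diagonal d * (1 + lam • U n)) N u :
        EuclideanSpace ℝ (Fin (L + 1))) = w := by
  induction h with
  | refl => exact ⟨0, fun _ => 1, by simp, 1, one_pos, one_smul _ _⟩
  | tail _ hstep ih =>
    obtain ⟨N, U, hU, c, hc, hcw⟩ := ih (hstep.ne_zero_left hw)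
    rw [← hcw] at hstep
    obtain ⟨U', hU', a, ha, haw⟩ := hstep.exists_orthogonal hlam hlam1 hc hw
    refine ⟨N + 1, Function.update U N U', fun n hn => ?_, a, ha, ?_⟩
    · rcases Nat.lt_succ_iff_lt_or_eq.1 hn with hn | rfl
      · rw [Function.update_of_ne hn.ne]
        exact hU n hn
      · rwa [Function.update_self]
    · rw [chainD, Function.update_self, chainD_congr (M' := fun n => diagonal d * (1 + lam • U n)),
        haw]
      intro n hn
      rw [Function.update_of_ne hn.ne]

theorem stmt11 {L : ℕ} (hL : 2 ≤ L) {Ω : Type*} [MeasurableSpace Ω]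
    (P : Measure Ω) [IsProbabilityMeasure P]
    (lam : ℝ) (hlam : lam ∈ Set.Ioo (0:ℝ) 1)
    (r : Ω → ℝ) (hr : Measurable r) (hr01 : ∀ ω, r ω ∈ Set.Icc (0:ℝ) 1)
    (κ : ℕ → ℝ) (hκpos : ∀ i, 1 ≤ i → i ≤ L+1 → 0 < κ i)
    (hκmono : ∀ i j, 1 ≤ i → i ≤ j → j ≤ L+1 → κ j ≤ κ i)
    (R : Matrix (Fin (L+1)) (Fin (L+1)) ℝ)
    (hR : R = Matrix.diagonal fun k : Fin (L+1) => κ (L+1-(k:ℕ)))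
    (hbig : ∀ i, 1 ≤ i → i ≤ L → (κ i - κ (i+1)) / κ (i+1) < lam)
    (hone : (1:ℝ) ∈ msupport (Measure.map r P))
    (u w : Sph L) :
    ∃ (N : ℕ) (s : ℕ → ℝ) (𝒰 : ℕ → Matrix (Fin (L+1)) (Fin (L+1)) ℝ),
      (∀ n < N, s n ∈ msupport (Measure.map r P)) ∧
      (∀ n < N, 𝒰 n ∈ Matrix.orthogonalGroup (Fin (L+1)) ℝ) ∧
      chainD (fun n => R * (1 + (lam * s n) • 𝒰 n)) N u = w := by
  have hnorm : ∀ x : Sph L, ‖(x : EuclideanSpace ℝ (Fin (L + 1)))‖ = 1 := fun x =>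
    mem_sphere_zero_iff_norm.1 x.2
  have hne : ∀ x : Sph L, (x : EuclideanSpace ℝ (Fin (L + 1))) ≠ 0 := fun x =>
    norm_ne_zero_iff.1 (by rw [hnorm]; exact one_ne_zero)
  have hreach : ControlReach lam (fun k : Fin (L + 1) => κ (L + 1 - (k : ℕ)))
      (u : EuclideanSpace ℝ (Fin (L + 1))) w := by
    refine ControlReach.of_ne_zero (by omega) hlam.1 (fun k => hκpos _ (by omega) (by omega))
      (fun k l hkl => hκmono _ _ (by omega) ?_ (by omega)) (fun k => ?_) (hne u) (hne w)
    · have : (k : ℕ) ≤ l := hkl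
      omega
    · have h := hbig (L - k) (by omega) (by omega)
      rw [div_lt_iff₀ (hκpos _ (by omega) (by omega))] at h
      have h1 : L + 1 - ((k.succ : Fin (L + 1)) : ℕ) = L - k := by
        rw [Fin.val_succ]; omega
      have h2 : L + 1 - ((k.castSucc : Fin (L + 1)) : ℕ) = L - k + 1 := by
        rw [Fin.val_castSucc]; omega
      simp only [h1, h2]
      linarith
  obtain ⟨N, U, hU, c, hc, hcw⟩ := hreach.exists_chainD hlam.1 hlam.2 (hne w)
  refine ⟨N, fun _ => 1, U, fun _ _ => hone, hU, Subtype.ext ?_⟩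
  have hc1 : c = 1 := by
    have := congrArg norm hcw
    rwa [norm_smul, hnorm, hnorm, mul_one, Real.norm_eq_abs, abs_of_pos hc] at this
  rw [hc1, one_smul] at hcw
  simpa only [hR, mul_one] using hcw
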